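/- arXiv:2212.07193 — 10 statements merged into one kernel-verified Lean document; each statement's English description precedes it below -/
import Mathlib

section
/- If u is a non-bypass vertex of a graph G (i.e., u is the middle vertex of some convex path of length 2) and X is a total mutual-visibility set of G, then u ∉ X. -/
open SimpleGraph

/-- `X` is a total mutual-visibility set of `G`: every pair of vertices `x, y` admits a
shortest `x,y`-path whose vertices in `X` are among `{x, y}`. -/
def IsTotalMVSet {V : Type*} (G : SimpleGraph V) (X : Set V) : Prop :=
  ∀ x y : V, ∃ p : G.Walk x y, p.IsPath ∧ p.length = G.dist x y ∧
    ∀ z ∈ p.support, z ∈ X → z = x ∨ z = y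

/-- The total mutual-visibility number of `G`. -/
noncomputable def totalMVNum {V : Type*} (G : SimpleGraph V) : ℕ :=
  sSup {n : ℕ | ∃ X : Set V, IsTotalMVSet G X ∧ X.ncard = n}

/-- `S` is an independent set of `G`. -/
def IsIndepVSet {V : Type*} (G : SimpleGraph V) (S : Set V) : Prop :=
  ∀ x ∈ S, ∀ y ∈ S, ¬ G.Adj x y

/-- The independent total mutual-visibility number of `G`. -/
noncomputable def indepTotalMVNum {V : Type*} (G : SimpleGraph V) : ℕ :=
  sSup {n : ℕ | ∃ X : Set V, IsTotalMVSet G X ∧ IsIndepVSet G X ∧ X.ncard = n}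

/-- `u` is a bypass vertex of `G` if it is not the middle vertex of a convex path of
length 2, i.e. there are no vertices `x ≠ y` with `x, y` nonadjacent and `u` their unique
common neighbour. -/
def IsBypassVertex {V : Type*} (G : SimpleGraph V) (u : V) : Prop :=
  ¬ ∃ x y : V, x ≠ y ∧ ¬ G.Adj x y ∧ G.Adj x u ∧ G.Adj u y ∧
      ∀ w : V, G.Adj x w → G.Adj w y → w = u

/-- The number of bypass vertices of `G`. -/
noncomputable def bpNum {V : Type*} (G : SimpleGraph V) : ℕ :=
  {u : V | IsBypassVertex G u}.ncard

/-- If `u` is a non-bypass vertex of `G` and `X` is a total mutual-visibility set of `G`,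
then `u ∉ X`. -/
theorem not_mem_totalMVSet_of_not_bypass {V : Type*} [Fintype V] (G : SimpleGraph V)
    (hG : G.Connected) (u : V) (hu : ¬ IsBypassVertex G u)
    (X : Set V) (hX : IsTotalMVSet G X) :
    u ∉ X := by
  intro huX
  obtain ⟨x, y, hne, hxy, hxu, huy, huniq⟩ := not_not.mp hu
  obtain ⟨p, -, hlen, hvis⟩ := hX x y
  have hle : p.length ≤ 2 := hlen ▸ dist_le (Walk.cons hxu (Walk.cons huy Walk.nil))
  have hmem : u ∈ p.support := by
    match p, hle with
    | .nil, _ => exact absurd rfl hne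
    | .cons h .nil, _ => exact absurd h hxy
    | .cons h (.cons h' .nil), _ =>
      obtain rfl := huniq _ h h'
      simp
    | .cons _ (.cons _ (.cons _ _)), hle =>
      simp only [Walk.length_cons] at hle
      omega
  rcases hvis u hmem huX with h | h
  · exact hxu.ne h.symm
  · exact huy.ne h
end

section
/- For every graph G, the total mutual-visibility number satisfies μt(G) ≤ bp(G), where bp(G) is the number of bypass vertices of G. -/
open SimpleGraph

/-- Every vertex of a total mutual-visibility set is a bypass vertex. -/
theorem IsTotalMVSet.subset_setOf_isBypassVertex {V : Type*} {G : SimpleGraph V} {X : Set V}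
    (hX : IsTotalMVSet G X) : X ⊆ {u | IsBypassVertex G u} := by
  rintro u hu ⟨x, y, hxy, hnadj, hxu, huy, huniq⟩
  obtain ⟨p, -, hlen, hp⟩ := hX x y
  have hle : p.length ≤ 2 := hlen ▸ G.dist_le (Walk.cons hxu (Walk.cons huy Walk.nil))
  match p with
  | .nil => exact hxy rfl
  | .cons h .nil => exact hnadj h
  | .cons h (.cons h' .nil) =>
    rcases hp u (by simp [huniq _ h h']) hu with rfl | rfl
    · exact G.irrefl hxu
    · exact G.irrefl huy
  | .cons _ (.cons _ (.cons _ _)) =>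
    simp only [Walk.length_cons] at hle
    omega

/-- For every graph `G`, the total mutual-visibility number is at most the number of bypass
vertices of `G`. -/
theorem totalMVNum_le_bpNum {V : Type*} [Fintype V] (G : SimpleGraph V) (hG : G.Connected) :
    totalMVNum G ≤ bpNum G := by
  refine csSup_le' ?_
  rintro n ⟨X, hX, rfl⟩
  exact Set.ncard_le_ncard hX.subset_setOf_isBypassVertex (Set.toFinite _)
end

section
/- Let G be a graph with at least 2 vertices and u a vertex of G. Then the singleton {u} is a total mutual-visibility set of G if and only if u is a bypass vertex. -/
open SimpleGraph

/-- If `u` is a bypass vertex, any shortest walk starting at a vertex other than `u` can be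
rerouted to a walk of the same length that does not have `u` as an inner vertex. -/
theorem IsBypassVertex.exists_walk_avoiding {V : Type*} {G : SimpleGraph V} {u : V}
    (hu : IsBypassVertex G u) {x y : V} (p : G.Walk x y) (hp : p.length = G.dist x y)
    (hx : x ≠ u) : ∃ q : G.Walk x y, q.length = p.length ∧ (u ∈ q.support → u = y) := by
  induction p with
  | nil => exact ⟨.nil, rfl, by simp⟩
  | @cons x a y h p ih =>
    have hpa : p.length = G.dist a y := by
      refine le_antisymm ?_ (dist_le p)
      obtain ⟨r, hr⟩ := p.reachable.exists_walk_length_eq_dist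
      have := dist_le (Walk.cons h r)
      simp only [Walk.length_cons] at hp this
      omega
    by_cases hau : a = u
    · subst hau
      cases p with
      | nil => exact ⟨.cons h .nil, rfl, fun _ => rfl⟩
      | @cons _ b _ h₂ r =>
        have hxb : x ≠ b := by
          rintro rfl
          have := dist_le r
          simp only [Walk.length_cons] at hp
          omega
        have hnadj : ¬ G.Adj x b := by
          intro hadj
          have := dist_le (Walk.cons hadj r)
          simp only [Walk.length_cons] at hp this
          omega
        obtain ⟨w, hxw, hwb, hwa⟩ : ∃ w, G.Adj x w ∧ G.Adj w b ∧ w ≠ a := by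
          by_contra! hw
          exact hu ⟨x, b, hxb, hnadj, h, h₂, hw⟩
        have har : a ∉ r.support :=
          ((Walk.cons_isPath_iff _ _).1 (Walk.isPath_of_length_eq_dist _ hpa)).2
        refine ⟨.cons hxw (.cons hwb r), rfl, fun ha => ?_⟩
        simp [hx.symm, hwa.symm, har] at ha
    · obtain ⟨q, hq, hqu⟩ := ih hpa hau
      refine ⟨.cons h q, by simp [hq], fun hmem => hqu ?_⟩
      simpa [hx.symm] using hmem

/-- For a graph `G` with at least two vertices, the singleton `{u}` is a total
mutual-visibility set of `G` iff `u` is a bypass vertex. -/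
theorem singleton_totalMVSet_iff_bypass {V : Type*} [Fintype V] (G : SimpleGraph V)
    (hG : G.Connected) (hn : 2 ≤ Fintype.card V) (u : V) :
    IsTotalMVSet G {u} ↔ IsBypassVertex G u := by
  constructor
  · rintro h ⟨x, y, hxy, hnadj, hxu, huy, huniq⟩
    obtain ⟨p, -, hlen, hp⟩ := h x y
    have hle := dist_le (Walk.cons hxu (Walk.cons huy Walk.nil))
    rw [← hlen] at hle
    match p with
    | .nil => exact hxy rfl
    | .cons hadj .nil => exact hnadj hadj
    | .cons (v := w) h₁ (.cons h₂ .nil) =>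
      obtain rfl := huniq w h₁ h₂
      rcases hp w (by simp) rfl with rfl | rfl
      · exact hxu.ne rfl
      · exact huy.ne rfl
    | .cons _ (.cons _ (.cons _ _)) =>
      simp only [Walk.length_cons, Walk.length_nil] at hle
      omega
  · intro hu x y
    obtain ⟨p, hp⟩ := hG.exists_walk_length_eq_dist x y
    by_cases hx : x = u
    · exact ⟨p, p.isPath_of_length_eq_dist hp, hp, fun z _ hz => .inl (hz.trans hx.symm)⟩
    · obtain ⟨q, hq, hqu⟩ := hu.exists_walk_avoiding p hp hx
      have hqd := hq.trans hp
      refine ⟨q, q.isPath_of_length_eq_dist hqd, hqd, ?_⟩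
      rintro z hz rfl
      exact .inr (hqu hz)
end

section
/- Let G be a graph with at least 2 vertices. Then μt(G) = 0 if and only if bp(G) = 0, i.e., G has no total mutual-visibility set other than the empty set if and only if G has no bypass vertices. -/
open SimpleGraph

namespace IsTotalMVSet

/-- Every vertex of a total mutual-visibility set is a bypass vertex. -/
theorem isBypassVertex {V : Type*} {G : SimpleGraph V} {X : Set V}
    (hX : IsTotalMVSet G X) {u : V} (hu : u ∈ X) : IsBypassVertex G u := by
  rintro ⟨x, y, hxy, hnadj, hxu, huy, huniq⟩
  obtain ⟨p, -, hlen, hvis⟩ := hX x y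
  have hle : p.length ≤ 2 := by
    rw [hlen]
    exact dist_le (Walk.cons hxu (Walk.cons huy Walk.nil))
  match p, hle, hvis with
  | .nil, _, _ => exact hxy rfl
  | .cons h .nil, _, _ => exact hnadj h
  | .cons (v := w) h (.cons h' .nil), _, hvis =>
    obtain rfl := huniq w h h'
    rcases hvis w (by simp) hu with rfl | rfl
    · exact G.loopless.irrefl _ hxu
    · exact G.loopless.irrefl _ huy
  | .cons _ (.cons _ (.cons _ r)), hle, _ =>
    simp only [Walk.length_cons] at hle
    omega

end IsTotalMVSet

/-- A shortest walk between vertices other than a bypass vertex `u` can be rerouted to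
avoid `u`. -/
theorem IsBypassVertex.exists_walk_notMem_support {V : Type*} {G : SimpleGraph V} {u : V}
    (hu : IsBypassVertex G u) {x y : V} (p : G.Walk x y) (hp : p.length = G.dist x y)
    (hx : x ≠ u) (hy : y ≠ u) : ∃ q : G.Walk x y, q.length = G.dist x y ∧ u ∉ q.support := by
  induction p with
  | nil => exact ⟨Walk.nil, hp, by simpa using hx.symm⟩
  | @cons x v y h p ih =>
    have hp' : p.length = G.dist v y := by
      obtain ⟨r, hr⟩ := p.reachable.exists_walk_length_eq_dist
      have h₁ := dist_le (Walk.cons h r)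
      have h₂ := dist_le p
      simp only [Walk.length_cons] at h₁ hp
      omega
    by_cases hv : v = u
    · subst hv
      cases p with
      | nil => exact absurd rfl hy
      | @cons _ b _ h' p =>
        have hpath := Walk.isPath_of_length_eq_dist _ hp'
        rw [Walk.cons_isPath_iff] at hpath
        simp only [Walk.length_cons] at hp
        have hxb : x ≠ b := by
          rintro rfl
          have := dist_le p
          omega
        have hnadj : ¬ G.Adj x b := fun hadj => by
          have := dist_le (Walk.cons hadj p)
          simp only [Walk.length_cons] at this
          omega
        obtain ⟨w, hxw, hwb, hwv⟩ : ∃ w, G.Adj x w ∧ G.Adj w b ∧ w ≠ v := by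
          by_contra! hcon
          exact hu ⟨x, b, hxb, hnadj, h, h', hcon⟩
        refine ⟨Walk.cons hxw (Walk.cons hwb p), by simpa using hp, ?_⟩
        simp [hx.symm, hwv.symm, hpath.2]
    · obtain ⟨q, hq, hqu⟩ := ih hp' hv hy
      refine ⟨Walk.cons h q, ?_, by simp [hx.symm, hqu]⟩
      rw [Walk.length_cons, hq, ← hp', ← hp, Walk.length_cons]

/-- A bypass vertex of a connected graph forms a total mutual-visibility set. -/
theorem IsBypassVertex.isTotalMVSet_singleton {V : Type*} {G : SimpleGraph V} {u : V}
    (hG : G.Connected) (hu : IsBypassVertex G u) : IsTotalMVSet G {u} := by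
  intro x y
  obtain ⟨p, hp⟩ := hG.exists_walk_length_eq_dist x y
  by_cases hxy : u = x ∨ u = y
  · refine ⟨p, p.isPath_of_length_eq_dist hp, hp, ?_⟩
    rintro z - rfl
    exact hxy
  · push Not at hxy
    obtain ⟨q, hq, hqu⟩ := hu.exists_walk_notMem_support p hp hxy.1.symm hxy.2.symm
    refine ⟨q, q.isPath_of_length_eq_dist hq, hq, ?_⟩
    rintro z hz rfl
    exact absurd hz hqu

/-- In a finite graph, `μt(G) = 0` iff every total mutual-visibility set is empty. -/
theorem totalMVNum_eq_zero_iff {V : Type*} [Finite V] {G : SimpleGraph V} :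
    totalMVNum G = 0 ↔ ∀ X : Set V, IsTotalMVSet G X → X = ∅ := by
  constructor
  · intro h X hX
    have hbdd : BddAbove {n : ℕ | ∃ X : Set V, IsTotalMVSet G X ∧ X.ncard = n} := by
      refine ⟨Nat.card V, ?_⟩
      rintro _ ⟨Y, -, rfl⟩
      exact Set.ncard_le_card Y
    have hle : X.ncard ≤ totalMVNum G := le_csSup hbdd ⟨X, hX, rfl⟩
    rw [h, Nat.le_zero] at hle
    exact (Set.ncard_eq_zero).mp hle
  · intro h
    refine Nat.le_zero.mp (csSup_le' ?_)
    rintro _ ⟨X, hX, rfl⟩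
    simp [h X hX]

/-- For a graph `G` with at least two vertices, `μt(G) = 0` iff `bp(G) = 0`. -/
theorem totalMVNum_eq_zero_iff_bpNum_eq_zero {V : Type*} [Fintype V] (G : SimpleGraph V)
    (hG : G.Connected) (hn : 2 ≤ Fintype.card V) :
    totalMVNum G = 0 ↔ bpNum G = 0 := by
  rw [totalMVNum_eq_zero_iff, bpNum, Set.ncard_eq_zero, Set.eq_empty_iff_forall_notMem]
  constructor
  · exact fun h u hu => Set.singleton_ne_empty u (h _ (hu.isTotalMVSet_singleton hG))
  · exact fun h X hX => Set.eq_empty_iff_forall_notMem.mpr fun u hu => h u (hX.isBypassVertex hu)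
end

section
/- Let G be a graph containing a cycle whose girth satisfies g(G) ≥ 5. Then μt(G) = 0 if and only if the minimum degree of G is at least 2. -/
open SimpleGraph

/-- The number of vertices of a total mutual-visibility set is at most `totalMVNum G`. -/
theorem IsTotalMVSet.ncard_le_totalMVNum {V : Type*} [Finite V] {G : SimpleGraph V} {X : Set V}
    (hX : IsTotalMVSet G X) : X.ncard ≤ totalMVNum G := by
  refine le_csSup ⟨Nat.card V, ?_⟩ ⟨X, hX, rfl⟩
  rintro n ⟨Y, -, rfl⟩
  exact Set.ncard_le_card Y

/-- An inner vertex of a path has degree at least `2`. -/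
theorem SimpleGraph.Walk.IsPath.two_le_degree_of_mem_support {V : Type*} {G : SimpleGraph V}
    {x y v : V} [Fintype (G.neighborSet v)] {p : G.Walk x y} (hp : p.IsPath)
    (hv : v ∈ p.support) (hx : v ≠ x) (hy : v ≠ y) : 2 ≤ G.degree v := by
  obtain ⟨i, rfl, hi⟩ := p.mem_support_iff_exists_getVert.1 hv
  have hi0 : i ≠ 0 := by
    rintro rfl
    simp at hx
  have hil : i ≠ p.length := by
    rintro rfl
    simp at hy
  obtain ⟨j, rfl⟩ := Nat.exists_eq_succ_of_ne_zero hi0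
  have h₁ := (p.adj_getVert_succ (i := j) (by omega)).symm
  have h₂ := p.adj_getVert_succ (i := j + 1) (by omega)
  rw [← card_neighborFinset_eq_degree]
  refine Finset.one_lt_card.2 ⟨_, (G.mem_neighborFinset _ _).2 h₁, _,
    (G.mem_neighborFinset _ _).2 h₂, fun h => ?_⟩
  have := hp.getVert_injOn (x₁ := j) (x₂ := j + 1 + 1) (by simp; omega) (by simp; omega) h
  omega

/-- In a connected graph, a vertex of degree at most `1` forms a total mutual-visibility set. -/
theorem isTotalMVSet_singleton_of_degree_le_one {V : Type*} {G : SimpleGraph V}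
    (hG : G.Connected) {v : V} [Fintype (G.neighborSet v)] (hv : G.degree v ≤ 1) :
    IsTotalMVSet G {v} := by
  intro x y
  obtain ⟨p, hp, hl⟩ := hG.exists_path_of_dist x y
  refine ⟨p, hp, hl, ?_⟩
  rintro z hz rfl
  by_contra! h
  have := hp.two_le_degree_of_mem_support hz h.1 h.2
  omega

/-- A graph of girth at least `4` has no triangles. -/
theorem SimpleGraph.not_adj_of_four_le_girth {V : Type*} {G : SimpleGraph V}
    (hg : 4 ≤ G.girth) {x u y : V} (hxu : G.Adj x u) (huy : G.Adj u y) : ¬ G.Adj x y := by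
  intro hxy
  have hc : (Walk.cons hxu (Walk.cons huy (Walk.cons hxy.symm Walk.nil))).IsCycle := by
    simp [Walk.cons_isCycle_iff, hxu.ne, hxu.ne', huy.ne, hxy.ne, hxy.ne']
  have := hc.girth_le_length
  simp at this
  omega

/-- In a graph of girth at least `5`, two vertices have at most one common neighbor. -/
theorem SimpleGraph.eq_of_common_neighbor_of_five_le_girth {V : Type*} {G : SimpleGraph V}
    (hg : 5 ≤ G.girth) {x y u w : V} (hxy : x ≠ y) (hxu : G.Adj x u) (huy : G.Adj u y)
    (hxw : G.Adj x w) (hwy : G.Adj w y) : w = u := by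
  by_contra hwu
  have hc : (Walk.cons hxu (Walk.cons huy (Walk.cons hwy.symm
      (Walk.cons hxw.symm Walk.nil)))).IsCycle := by
    simp [Walk.cons_isCycle_iff, hxu.ne, hxu.ne', huy.ne, hxy, hxy.symm,
      Ne.symm hwu, hxw.ne, hxw.ne', hwy.ne']
  have := hc.girth_le_length
  simp at this
  omega

/-- In a graph of girth at least `5`, a total mutual-visibility set contains no vertex of degree
at least `2`. -/
theorem IsTotalMVSet.notMem_of_two_le_degree {V : Type*} {G : SimpleGraph V} {X : Set V}
    (hX : IsTotalMVSet G X) (hg : 5 ≤ G.girth) {u : V} [Fintype (G.neighborSet u)]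
    (hu : 2 ≤ G.degree u) : u ∉ X := by
  intro huX
  rw [← card_neighborFinset_eq_degree] at hu
  obtain ⟨x, hx, y, hy, hxy⟩ := Finset.one_lt_card.1 hu
  rw [mem_neighborFinset] at hx hy
  have hnadj := not_adj_of_four_le_girth (by omega) hx.symm hy
  obtain ⟨p, -, hl, hpX⟩ := hX x y
  have hd : G.dist x y ≤ 2 := dist_le (Walk.cons hx.symm (Walk.cons hy Walk.nil))
  rw [← hl] at hd
  match p with
  | .nil => exact hxy rfl
  | .cons h .nil => exact hnadj h
  | .cons (v := w) h (.cons h' .nil) =>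
    have hwu := eq_of_common_neighbor_of_five_le_girth hg hxy hx.symm hy h h'
    subst hwu
    rcases hpX w (by simp) huX with h₁ | h₁
    · exact hx.ne h₁
    · exact hy.ne h₁
  | .cons _ (.cons _ (.cons _ q)) =>
    simp at hd

/-- If `G` contains a cycle and its girth is at least `5`, then `μt(G) = 0` iff the minimum
degree of `G` is at least `2`. -/
theorem totalMVNum_eq_zero_iff_minDegree_of_girth {V : Type*} [Fintype V] (G : SimpleGraph V)
    [DecidableRel G.Adj] (hG : G.Connected) (hcyc : ¬ G.IsAcyclic) (hg : 5 ≤ G.girth) :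
    totalMVNum G = 0 ↔ ∀ v : V, 2 ≤ G.degree v := by
  constructor
  · intro h v
    by_contra! hv
    have := (isTotalMVSet_singleton_of_degree_le_one hG
      (by omega : G.degree v ≤ 1)).ncard_le_totalMVNum
    rw [Set.ncard_singleton] at this
    omega
  · intro h
    unfold totalMVNum
    refine Nat.eq_zero_of_le_zero (csSup_le' ?_)
    rintro n ⟨X, hX, rfl⟩
    have hXe : X = ∅ := Set.eq_empty_iff_forall_notMem.2
      fun u => hX.notMem_of_two_le_degree hg (h u)
    simp [hXe]
end

section
/- If G and H are connected graphs of order at least 2 with μit(G) ≥ 1 and μit(H) ≥ 1, then max{ μit(H)·μt(G), μit(G)·μt(H) } ≤ μt(G □ H) ≤ min{ μt(G)·n(H), μt(H)·n(G) }, where n(G) and n(H) denote the orders of G and H. -/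
open SimpleGraph

/-- Total mutual-visibility is a local condition: it suffices to look at pairs of vertices at
distance two. -/
theorem isTotalMVSet_iff_of_connected {V : Type*} {G : SimpleGraph V} (hG : G.Connected)
    {X : Set V} :
    IsTotalMVSet G X ↔ ∀ x y u : V, x ≠ y → ¬ G.Adj x y → G.Adj x u → G.Adj u y →
      ∃ w, G.Adj x w ∧ G.Adj w y ∧ w ∉ X := by
  constructor
  · intro hX x y u hne hadj hxu huy
    obtain ⟨p, -, hlen, hp⟩ := hX x y
    have hle : p.length ≤ 2 := by
      rw [hlen]
      exact G.dist_le (Walk.cons hxu (Walk.cons huy Walk.nil))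
    match p with
    | .nil => exact absurd rfl hne
    | .cons h .nil => exact absurd h hadj
    | .cons (v := w) h (.cons h' .nil) =>
      refine ⟨w, h, h', fun hw => ?_⟩
      rcases hp w (by simp) hw with rfl | rfl
      · exact h.ne rfl
      · exact h'.ne rfl
    | .cons h (.cons h' (.cons h'' q)) =>
      simp only [Walk.length_cons] at hle
      omega
  · intro hX x y
    suffices key : ∀ {x y : V} (p : G.Walk x y), p.length = G.dist x y →
        ∃ q : G.Walk x y, q.length = G.dist x y ∧
          ∀ z ∈ q.support, z ∈ X → z = x ∨ z = y by
      obtain ⟨p, hp⟩ := hG.exists_walk_length_eq_dist x y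
      obtain ⟨q, hq, hqX⟩ := key p hp
      exact ⟨q, q.isPath_of_length_eq_dist hq, hq, hqX⟩
    intro x y p
    induction p with
    | nil => exact fun hp => ⟨Walk.nil, hp, fun z hz _ => Or.inl (by simpa using hz)⟩
    | @cons x u y h p ih =>
      intro hp
      rw [Walk.length_cons] at hp
      have htri : G.dist x y ≤ G.dist u y + 1 := by
        have := hG.dist_triangle (u := x) (v := u) (w := y)
        rw [dist_eq_one_iff_adj.2 h] at this
        omega
      obtain ⟨q, hq, hqX⟩ := ih (le_antisymm (by omega) (G.dist_le p))
      have hdist : G.dist x y = G.dist u y + 1 :=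
        le_antisymm htri (by have := G.dist_le p; omega)
      have hqpath := q.isPath_of_length_eq_dist hq
      match q with
      | .nil => exact ⟨Walk.cons h Walk.nil, by simp [dist_eq_one_iff_adj.2 h], fun z hz _ => by simpa using hz⟩
      | .cons (v := v) h' r =>
        rw [Walk.length_cons] at hq
        have hxv : x ≠ v := by
          rintro rfl
          have := G.dist_le r
          omega
        have hnadj : ¬ G.Adj x v := fun hadj => by
          have := G.dist_le (Walk.cons hadj r)
          rw [Walk.length_cons] at this
          omega
        obtain ⟨w, hxw, hwv, hwX⟩ := hX x v u hxv hnadj h h'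
        refine ⟨Walk.cons hxw (Walk.cons hwv r), by simp only [Walk.length_cons]; omega, ?_⟩
        intro z hz hzX
        simp only [Walk.support_cons, List.mem_cons] at hz
        rcases hz with rfl | rfl | hz
        · exact Or.inl rfl
        · exact absurd hzX hwX
        · rcases hqX z (by simp [hz]) hzX with rfl | rfl
          · exact absurd hz ((Walk.cons_isPath_iff _ _).1 hqpath).2
          · exact Or.inr rfl

theorem isTotalMVSet_empty {V : Type*} {G : SimpleGraph V} (hG : G.Connected) :
    IsTotalMVSet G ∅ :=
  (isTotalMVSet_iff_of_connected hG).2 fun _ _ u _ _ h h' => ⟨u, h, h', Set.notMem_empty u⟩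

theorem bddAbove_setOf_exists_ncard_eq {V : Type*} [Finite V] (P : Set V → Prop) :
    BddAbove {n : ℕ | ∃ X : Set V, P X ∧ X.ncard = n} := by
  refine ⟨Nat.card V, ?_⟩
  rintro _ ⟨X, -, rfl⟩
  exact Set.ncard_le_card X

theorem exists_isTotalMVSet_ncard_eq_totalMVNum {V : Type*} [Finite V] {G : SimpleGraph V}
    (hG : G.Connected) : ∃ X : Set V, IsTotalMVSet G X ∧ X.ncard = totalMVNum G :=
  Nat.sSup_mem (s := {n : ℕ | ∃ X : Set V, IsTotalMVSet G X ∧ X.ncard = n})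
    ⟨_, ∅, isTotalMVSet_empty hG, rfl⟩ (bddAbove_setOf_exists_ncard_eq _)

theorem exists_isTotalMVSet_isIndepVSet_ncard_eq_indepTotalMVNum {V : Type*} [Finite V]
    {G : SimpleGraph V} (hG : G.Connected) :
    ∃ X : Set V, IsTotalMVSet G X ∧ IsIndepVSet G X ∧ X.ncard = indepTotalMVNum G := by
  have h := Nat.sSup_mem (s := {n : ℕ | ∃ X : Set V,
    (IsTotalMVSet G X ∧ IsIndepVSet G X) ∧ X.ncard = n})
    ⟨_, ∅, ⟨isTotalMVSet_empty hG, fun _ hx => absurd hx (Set.notMem_empty _)⟩, rfl⟩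
    (bddAbove_setOf_exists_ncard_eq _)
  simpa only [and_assoc, indepTotalMVNum, Set.mem_ofPred_eq] using h

theorem totalMVNum_le_of_iso {V W : Type*} [Finite V] [Finite W] {G : SimpleGraph V}
    {H : SimpleGraph W} (hG : G.Connected) (hH : H.Connected) (e : G ≃g H) :
    totalMVNum G ≤ totalMVNum H := by
  obtain ⟨X, hX, hcard⟩ := exists_isTotalMVSet_ncard_eq_totalMVNum hG
  rw [isTotalMVSet_iff_of_connected hG] at hX
  rw [← hcard, ← Set.ncard_image_of_injective X e.injective]
  refine IsTotalMVSet.ncard_le_totalMVNum ((isTotalMVSet_iff_of_connected hH).2 ?_)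
  intro x y u hne hadj hxu huy
  obtain ⟨w, hxw, hwy, hw⟩ := hX (e.symm x) (e.symm y) (e.symm u) (e.symm.injective.ne hne)
    (by rwa [e.symm.map_adj_iff]) (e.symm.map_adj_iff.2 hxu) (e.symm.map_adj_iff.2 huy)
  refine ⟨e w, ?_, ?_, fun h => hw ((e.injective.mem_set_image).1 h)⟩
  · simpa using e.map_adj_iff.2 hxw
  · simpa using e.map_adj_iff.2 hwy

/-- The product of an independent total mutual-visibility set and a total mutual-visibility set
is a total mutual-visibility set of the Cartesian product. -/
theorem IsTotalMVSet.prod {V W : Type*} {G : SimpleGraph V} {H : SimpleGraph W}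
    (hG : G.Connected) (hH : H.Connected) {S : Set V} {T : Set W} (hS : IsTotalMVSet G S)
    (hSi : IsIndepVSet G S) (hT : IsTotalMVSet H T) : IsTotalMVSet (G □ H) (S ×ˢ T) := by
  rw [isTotalMVSet_iff_of_connected hG] at hS
  rw [isTotalMVSet_iff_of_connected hH] at hT
  rw [isTotalMVSet_iff_of_connected (hG.boxProd hH)]
  rintro ⟨a, b⟩ ⟨a', b'⟩ ⟨c, d⟩ hne hadj h h'
  simp only [boxProd_adj] at h h' hadj
  rcases h with ⟨h, rfl⟩ | ⟨h, rfl⟩ <;> rcases h' with ⟨h', rfl⟩ | ⟨h', rfl⟩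
  · obtain ⟨w, hw, hw', hwS⟩ := hS a a' c (by rintro rfl; exact hne rfl)
      (fun hadj' => hadj (Or.inl ⟨hadj', rfl⟩)) h h'
    exact ⟨(w, b), Or.inl ⟨hw, rfl⟩, Or.inl ⟨hw', rfl⟩, fun hmem => hwS hmem.1⟩
  · by_cases hc : c ∈ S
    · exact ⟨(a, b'), Or.inr ⟨h', rfl⟩, Or.inl ⟨h, rfl⟩, fun hmem => hSi a hmem.1 c hc h⟩
    · exact ⟨(c, b), Or.inl ⟨h, rfl⟩, Or.inr ⟨h', rfl⟩, fun hmem => hc hmem.1⟩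
  · by_cases ha : a ∈ S
    · exact ⟨(a', b), Or.inl ⟨h', rfl⟩, Or.inr ⟨h, rfl⟩, fun hmem => hSi a ha a' hmem.1 h'⟩
    · exact ⟨(a, d), Or.inr ⟨h, rfl⟩, Or.inl ⟨h', rfl⟩, fun hmem => ha hmem.1⟩
  · obtain ⟨w, hw, hw', hwT⟩ := hT b b' d (by rintro rfl; exact hne rfl)
      (fun hadj' => hadj (Or.inr ⟨hadj', rfl⟩)) h h'
    exact ⟨(a, w), Or.inr ⟨hw, rfl⟩, Or.inr ⟨hw', rfl⟩, fun hmem => hwT hmem.2⟩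

/-- Every `G`-layer of a total mutual-visibility set of `G □ H` is one of `G`. -/
theorem IsTotalMVSet.layer {V W : Type*} {G : SimpleGraph V} {H : SimpleGraph W}
    (hG : G.Connected) (hH : H.Connected) {X : Set (V × W)} (hX : IsTotalMVSet (G □ H) X)
    (b : W) : IsTotalMVSet G {a | (a, b) ∈ X} := by
  rw [isTotalMVSet_iff_of_connected (hG.boxProd hH)] at hX
  rw [isTotalMVSet_iff_of_connected hG]
  intro x y u hne hadj hxu huy
  obtain ⟨⟨w, d⟩, hw, hw', hwX⟩ := hX (x, b) (y, b) (u, b) (by simpa using hne)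
    (by rwa [boxProd_adj_left]) (boxProd_adj_left.2 hxu) (boxProd_adj_left.2 huy)
  simp only [boxProd_adj] at hw hw'
  rcases hw with ⟨hw, rfl⟩ | ⟨hw, rfl⟩
  · rcases hw' with ⟨hw', -⟩ | ⟨hw', -⟩
    · exact ⟨w, hw, hw', hwX⟩
    · exact absurd rfl hw'.ne
  · rcases hw' with ⟨-, rfl⟩ | ⟨-, rfl⟩
    · exact absurd rfl hw.ne
    · exact absurd rfl hne

theorem indepTotalMVNum_mul_totalMVNum_le {V W : Type*} [Finite V] [Finite W]
    {G : SimpleGraph V} {H : SimpleGraph W} (hG : G.Connected) (hH : H.Connected) :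
    indepTotalMVNum G * totalMVNum H ≤ totalMVNum (G □ H) := by
  obtain ⟨S, hS, hSi, hScard⟩ := exists_isTotalMVSet_isIndepVSet_ncard_eq_indepTotalMVNum hG
  obtain ⟨T, hT, hTcard⟩ := exists_isTotalMVSet_ncard_eq_totalMVNum hH
  rw [← hScard, ← hTcard, ← Set.ncard_prod]
  exact (IsTotalMVSet.prod hG hH hS hSi hT).ncard_le_totalMVNum

theorem totalMVNum_boxProd_le {V W : Type*} [Finite V] [Fintype W]
    {G : SimpleGraph V} {H : SimpleGraph W} (hG : G.Connected) (hH : H.Connected) :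
    totalMVNum (G □ H) ≤ totalMVNum G * Fintype.card W := by
  classical
  have := Fintype.ofFinite V
  obtain ⟨X, hX, hcard⟩ := exists_isTotalMVSet_ncard_eq_totalMVNum (hG.boxProd hH)
  rw [← hcard, Set.ncard_eq_toFinset_card', ← Finset.card_univ]
  refine Finset.card_le_mul_card_image_of_maps_to (f := Prod.snd) (fun _ _ => Finset.mem_univ _)
    _ fun b _ => ?_
  refine le_trans ?_ (hX.layer hG hH b).ncard_le_totalMVNum
  rw [Set.ncard_eq_toFinset_card']
  refine Finset.card_le_card_of_injOn Prod.fst ?_ ?_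
  · rintro ⟨a, b'⟩ h
    simp only [Finset.coe_filter, Set.mem_toFinset, Set.mem_ofPred_eq] at h
    obtain ⟨h, rfl⟩ := h
    simpa using h
  · rintro ⟨a, c⟩ h ⟨a', c'⟩ h' heq
    simp only [Finset.coe_filter, Set.mem_ofPred_eq] at h h'
    exact Prod.ext heq (h.2.trans h'.2.symm)

/-- If `G` and `H` are connected graphs of order at least `2` with `μit(G) ≥ 1` and
`μit(H) ≥ 1`, then
`max {μit(H)·μt(G), μit(G)·μt(H)} ≤ μt(G □ H) ≤ min {μt(G)·n(H), μt(H)·n(G)}`. -/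
theorem totalMVNum_boxProd_bounds {V W : Type*} [Fintype V] [Fintype W]
    (G : SimpleGraph V) (H : SimpleGraph W) (hG : G.Connected) (hH : H.Connected)
    (hnV : 2 ≤ Fintype.card V) (hnW : 2 ≤ Fintype.card W)
    (hiG : 1 ≤ indepTotalMVNum G) (hiH : 1 ≤ indepTotalMVNum H) :
    max (indepTotalMVNum H * totalMVNum G) (indepTotalMVNum G * totalMVNum H)
        ≤ totalMVNum (G □ H) ∧
      totalMVNum (G □ H)
        ≤ min (totalMVNum G * Fintype.card W) (totalMVNum H * Fintype.card V) := by
  have hcomm : totalMVNum (G □ H) ≤ totalMVNum (H □ G) :=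
    totalMVNum_le_of_iso (hG.boxProd hH) (hH.boxProd hG) (boxProdComm G H)
  have hcomm' : totalMVNum (H □ G) ≤ totalMVNum (G □ H) :=
    totalMVNum_le_of_iso (hH.boxProd hG) (hG.boxProd hH) (boxProdComm H G)
  exact ⟨max_le ((indepTotalMVNum_mul_totalMVNum_le hH hG).trans hcomm')
      (indepTotalMVNum_mul_totalMVNum_le hG hH),
    le_min (totalMVNum_boxProd_le hG hH) (hcomm.trans (totalMVNum_boxProd_le hH hG))⟩
end

section
/- For all integers n, m ≥ 2, the total mutual-visibility number of the Cartesian product of complete graphs satisfies μt(K_n □ K_m) = max{n, m}. -/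
open SimpleGraph

/-- A common neighbour of `x` and `y` outside `X` gives a visible shortest path between them. -/
lemma exists_isPath_of_common_neighbor {V : Type*} {G : SimpleGraph V} {X : Set V} {x y w : V}
    (hne : x ≠ y) (hxy : ¬ G.Adj x y) (hxw : G.Adj x w) (hwy : G.Adj w y) (hw : w ∉ X) :
    ∃ p : G.Walk x y, p.IsPath ∧ p.length = G.dist x y ∧
      ∀ z ∈ p.support, z ∈ X → z = x ∨ z = y := by
  let p : G.Walk x y := Walk.cons hxw (Walk.cons hwy Walk.nil)
  have hle : G.dist x y ≤ 2 := dist_le p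
  have hpos : 0 < G.dist x y := p.reachable.pos_dist_of_ne hne
  have hne1 : G.dist x y ≠ 1 := fun h => hxy (dist_eq_one_iff_adj.1 h)
  refine ⟨p, ?_, ?_, ?_⟩
  · simp [p, hne, hxw.ne, hwy.ne]
  · have : p.length = 2 := rfl
    omega
  · intro z hz hzX
    simp only [p, Walk.support_cons, Walk.support_nil, List.mem_cons, List.not_mem_nil,
      or_false] at hz
    rcases hz with rfl | rfl | rfl
    · exact .inl rfl
    · exact absurd hzX hw
    · exact .inr rfl

/-- Nonadjacent distinct vertices with a common neighbour have one outside a total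
mutual-visibility set. -/
lemma IsTotalMVSet.exists_common_neighbor_notMem {V : Type*} {G : SimpleGraph V} {X : Set V}
    (hX : IsTotalMVSet G X) {x y w : V} (hne : x ≠ y) (hxy : ¬ G.Adj x y)
    (hxw : G.Adj x w) (hwy : G.Adj w y) : ∃ v, G.Adj x v ∧ G.Adj v y ∧ v ∉ X := by
  obtain ⟨p, -, hlen, hp⟩ := hX x y
  have hle : p.length ≤ 2 := hlen.trans_le (dist_le (Walk.cons hxw (Walk.cons hwy Walk.nil)))
  match p, hle, hp with
  | .nil, _, _ => exact absurd rfl hne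
  | .cons h .nil, _, _ => exact absurd h hxy
  | .cons (v := v) h (.cons h' .nil), _, hp =>
    refine ⟨v, h, h', fun hv => ?_⟩
    rcases hp v (by simp) hv with rfl | rfl
    · exact h.ne rfl
    · exact h'.ne rfl
  | .cons _ (.cons _ (.cons _ _)), hle, _ =>
    simp only [Walk.length_cons] at hle
    omega

/-- Total mutual-visibility sets of a rook's graph are the sets of pairwise collinear cells. -/
lemma isTotalMVSet_top_boxProd_top_iff {α β : Type*} {X : Set (α × β)} :
    IsTotalMVSet ((⊤ : SimpleGraph α) □ (⊤ : SimpleGraph β)) X ↔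
      ∀ p ∈ X, ∀ q ∈ X, p.1 = q.1 ∨ p.2 = q.2 := by
  constructor
  · rintro hX ⟨a, b⟩ hp ⟨a', b'⟩ hq
    by_contra! h
    obtain ⟨ha, hb⟩ := h
    dsimp only at ha hb
    obtain ⟨⟨c, d⟩, h1, h2, hv⟩ := hX.exists_common_neighbor_notMem
      (x := (a, b')) (y := (a', b)) (w := (a, b))
      (by simp [ha]) (by simp [boxProd_adj, ha, hb.symm])
      (by simp [boxProd_adj, hb.symm]) (by simp [boxProd_adj, ha])
    simp only [boxProd_adj, top_adj] at h1 h2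
    grind
  · rintro hX ⟨a, b⟩ ⟨a', b'⟩
    by_cases hne : (a, b) = (a', b')
    · rw [← hne]
      exact ⟨.nil, by simp, by simp, by simp⟩
    by_cases hadj : ((⊤ : SimpleGraph α) □ (⊤ : SimpleGraph β)).Adj (a, b) (a', b')
    · refine ⟨hadj.toWalk, by simp [hne], ?_, by simp⟩
      simp [dist_eq_one_iff_adj.2 hadj]
    have hab : a ≠ a' ∧ b ≠ b' := by
      simp only [boxProd_adj, top_adj, Prod.mk.injEq] at hne hadj
      grind
    obtain ⟨ha, hb⟩ := hab
    by_cases hw : (a, b') ∈ X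
    · have hw' : (a', b) ∉ X := fun h => by
        rcases hX _ hw _ h with h | h
        · exact ha h
        · exact hb h.symm
      exact exists_isPath_of_common_neighbor hne hadj
        (by simp [boxProd_adj, ha]) (by simp [boxProd_adj, hb]) hw'
    · exact exists_isPath_of_common_neighbor hne hadj
        (by simp [boxProd_adj, hb]) (by simp [boxProd_adj, ha]) hw

/-- A set of pairwise collinear cells lies in a single row or a single column. -/
lemma injOn_snd_or_injOn_fst_of_collinear {α β : Type*} {X : Set (α × β)}
    (hX : ∀ p ∈ X, ∀ q ∈ X, p.1 = q.1 ∨ p.2 = q.2) :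
    Set.InjOn Prod.snd X ∨ Set.InjOn Prod.fst X := by
  by_contra! h
  simp only [Set.InjOn, not_forall] at h
  obtain ⟨⟨p, hp, q, hq, hpq, hne⟩, r, hr, s, hs, hrs, hne'⟩ := h
  have hpq' : p.1 ≠ q.1 := fun h => hne (Prod.ext h hpq)
  have hrs' : r.2 ≠ s.2 := fun h => hne' (Prod.ext hrs h)
  have h1 := hX p hp r hr
  have h2 := hX p hp s hs
  have h3 := hX q hq r hr
  have h4 := hX q hq s hs
  grind

/-- For `n, m ≥ 2`, `μt(K_n □ K_m) = max {n, m}`. -/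
theorem totalMVNum_complete_boxProd_complete (n m : ℕ) (hn : 2 ≤ n) (hm : 2 ≤ m) :
    totalMVNum ((⊤ : SimpleGraph (Fin n)) □ (⊤ : SimpleGraph (Fin m))) = max n m := by
  refine IsGreatest.csSup_eq ⟨?_, ?_⟩
  · rcases le_total n m with h | h
    · refine ⟨Set.range fun j : Fin m => ((⟨0, by omega⟩ : Fin n), j),
        isTotalMVSet_top_boxProd_top_iff.2 ?_, ?_⟩
      · rintro _ ⟨i, rfl⟩ _ ⟨j, rfl⟩
        exact .inl rfl
      · rw [Set.ncard_range_of_injective (Prod.mk_right_injective _), Nat.card_fin, max_eq_right h]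
    · refine ⟨Set.range fun i : Fin n => (i, (⟨0, by omega⟩ : Fin m)),
        isTotalMVSet_top_boxProd_top_iff.2 ?_, ?_⟩
      · rintro _ ⟨i, rfl⟩ _ ⟨j, rfl⟩
        exact .inr rfl
      · rw [Set.ncard_range_of_injective (Prod.mk_left_injective _), Nat.card_fin, max_eq_left h]
  · rintro _ ⟨X, hX, rfl⟩
    rcases injOn_snd_or_injOn_fst_of_collinear (isTotalMVSet_top_boxProd_top_iff.1 hX) with h | h
    · rw [← h.ncard_image]
      exact (Set.ncard_le_card _).trans (by simp)
    · rw [← h.ncard_image]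
      exact (Set.ncard_le_card _).trans (by simp)
end

section
/- For integers s ≥ 3 and n ≥ 3, the total mutual-visibility number of the Cartesian product of a cycle and a complete graph is μt(C_s □ K_n) = 0 if s ≥ 5, and μt(C_s □ K_n) = n if s ∈ {3, 4}. -/
open SimpleGraph

section TotalMutualVisibility

variable {α β V : Type*} {G : SimpleGraph α} {H : SimpleGraph V}

lemma isTotalMVSet_of_walk {X : Set V}
    (h : ∀ x y : V, ∃ p : H.Walk x y, p.length = H.dist x y ∧
      ∀ z ∈ p.support, z ∈ X → z = x ∨ z = y) : IsTotalMVSet H X := fun x y ↦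
  let ⟨p, hp, hX⟩ := h x y
  ⟨p, p.isPath_of_length_eq_dist hp, hp, hX⟩

lemma isTotalMVSet_empty_s11 (hH : H.Connected) : IsTotalMVSet H ∅ :=
  isTotalMVSet_of_walk fun x y ↦
    let ⟨p, hp⟩ := hH.exists_walk_length_eq_dist x y
    ⟨p, hp, by simp⟩

lemma dist_eq_two_of_adj_adj {x y u : V} (hne : x ≠ y) (hnadj : ¬ H.Adj x y)
    (hxu : H.Adj x u) (huy : H.Adj u y) : H.dist x y = 2 := by
  have hle : H.dist x y ≤ 2 := by
    simpa using dist_le (Walk.cons hxu (Walk.cons huy Walk.nil))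
  have hr : H.Reachable x y := hxu.reachable.trans huy.reachable
  have := hr.one_lt_dist_of_ne_of_not_adj hne hnadj
  omega

lemma IsTotalMVSet.exists_common_neighbor_notMem_s11 {X : Set V} (hX : IsTotalMVSet H X)
    {x y u : V} (hne : x ≠ y) (hnadj : ¬ H.Adj x y) (hxu : H.Adj x u) (huy : H.Adj u y) :
    ∃ w, H.Adj x w ∧ H.Adj w y ∧ w ∉ X := by
  obtain ⟨p, -, hlen, hp⟩ := hX x y
  rw [dist_eq_two_of_adj_adj hne hnadj hxu huy] at hlen
  match p, hlen, hp with
  | .cons (v := w) h (.cons h' .nil), _, hp =>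
    refine ⟨w, h, h', fun hw ↦ ?_⟩
    rcases hp w (by simp) hw with rfl | rfl
    · exact h.ne rfl
    · exact h'.ne rfl

lemma dist_boxProd_of_connected {H : SimpleGraph β} (hG : G.Connected) (hH : H.Connected)
    (x y : α × β) : (G □ H).dist x y = G.dist x.1 y.1 + H.dist x.2 y.2 := by
  have h := edist_boxProd (G := G) (H := H) x y
  rw [← ((hG.boxProd hH) x y).coe_dist_eq_edist, ← (hG x.1 y.1).coe_dist_eq_edist,
    ← (hH x.2 y.2).coe_dist_eq_edist] at h
  exact_mod_cast h

lemma IsTotalMVSet.exists_column_notMem {X : Set (α × β)}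
    (hX : IsTotalMVSet (G □ (⊤ : SimpleGraph β)) X) {c d a : α} (hne : c ≠ d)
    (hnadj : ¬ G.Adj c d) (hca : G.Adj c a) (had : G.Adj a d) (k : β) :
    ∃ w, G.Adj c w ∧ G.Adj w d ∧ (w, k) ∉ X := by
  obtain ⟨⟨w, l⟩, h1, h2, hw⟩ := hX.exists_common_neighbor_notMem_s11 (x := (c, k)) (y := (d, k))
    (u := (a, k)) (by simpa using hne) (by simpa using hnadj) (by simpa using hca)
    (by simpa using had)
  rw [boxProd_adj] at h1 h2
  simp only [top_adj] at h1 h2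
  grind

lemma IsTotalMVSet.eq_of_adj_of_mem {X : Set (α × β)}
    (hX : IsTotalMVSet (G □ (⊤ : SimpleGraph β)) X) {a b : α} {k l : β} (hab : G.Adj a b)
    (ha : (a, k) ∈ X) (hb : (b, l) ∈ X) : k = l := by
  by_contra hkl
  have hne := hab.ne
  obtain ⟨⟨w, m⟩, h1, h2, hw⟩ := hX.exists_common_neighbor_notMem_s11 (x := (a, l)) (y := (b, k))
    (u := (a, k)) (by simp [hne]) (by simp [boxProd_adj, hne, Ne.symm hkl])
    (by simp [Ne.symm hkl]) (by simpa using hab)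
  rw [boxProd_adj] at h1 h2
  simp only [top_adj] at h1 h2
  grind

lemma length_boxProdLeft {H : SimpleGraph β} {b c : α} (p : G.Walk b c) (k : β) :
    (p.boxProdLeft H k).length = p.length :=
  Walk.length_map _ _

lemma support_boxProdLeft {H : SimpleGraph β} {b c : α} (p : G.Walk b c) (k : β) :
    (p.boxProdLeft H k).support = p.support.map (·, k) :=
  Walk.support_map _ _

/-- If `{a}` is total mutual-visible in `G`, so is the complete fibre over `a` in `G □ ⊤`. -/
lemma IsTotalMVSet.fibre_boxProd_top [Nonempty β] (hG : G.Connected) {a : α}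
    (ha : IsTotalMVSet G {a}) :
    IsTotalMVSet (G □ (⊤ : SimpleGraph β)) (Prod.fst ⁻¹' {a}) := by
  refine isTotalMVSet_of_walk fun ⟨b, k⟩ ⟨c, l⟩ ↦ ?_
  rw [dist_boxProd_of_connected hG connected_top]
  obtain ⟨p, -, hlen, hp⟩ := ha b c
  rcases eq_or_ne k l with rfl | hkl
  · refine ⟨p.boxProdLeft ⊤ k, by simp [length_boxProdLeft, hlen], ?_⟩
    simp only [support_boxProdLeft, List.mem_map]
    rintro _ ⟨z, hz, rfl⟩ hza
    rcases hp z hz hza with rfl | rfl <;> simp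
  have hkl' : (⊤ : SimpleGraph β).Adj k l := hkl
  by_cases hb : b = a
  · refine ⟨(p.boxProdLeft ⊤ k).concat (v := (c, k)) (w := (c, l)) (by simpa using hkl), ?_, ?_⟩
    · simp [length_boxProdLeft, hlen, dist_eq_one_iff_adj.2 hkl']
    simp only [support_boxProdLeft, Walk.support_concat,
      List.mem_append, List.mem_map, List.mem_singleton]
    rintro _ (⟨z, hz, rfl⟩ | rfl) hza
    · left
      have : z = a := hza
      simp [this, hb]
    · simp
  · refine ⟨.cons (v := (b, l)) (by simpa using hkl) (p.boxProdLeft ⊤ l), ?_, ?_⟩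
    · simp [length_boxProdLeft, hlen, dist_eq_one_iff_adj.2 hkl', add_comm]
    simp only [support_boxProdLeft, Walk.support_cons, List.mem_cons, List.mem_map]
    rintro _ (rfl | ⟨z, hz, rfl⟩) hza
    · simp
    · rcases hp z hz hza with rfl | rfl
      · exact absurd hza hb
      · simp

lemma isTotalMVSet_singleton_of_common_neighbor {a : α}
    (h : ∀ x y, x = y ∨ G.Adj x y ∨ ∃ w, w ≠ a ∧ G.Adj x w ∧ G.Adj w y) :
    IsTotalMVSet G {a} := by
  refine isTotalMVSet_of_walk fun x y ↦ ?_
  by_cases hxy : x = y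
  · subst hxy
    exact ⟨.nil, by simp, by simp⟩
  by_cases hadj : G.Adj x y
  · exact ⟨.cons hadj .nil, by simp [dist_eq_one_iff_adj.2 hadj], by simp +contextual⟩
  obtain ⟨w, hw, h1, h2⟩ := ((h x y).resolve_left hxy).resolve_left hadj
  refine ⟨.cons h1 (.cons h2 .nil), by simp [dist_eq_two_of_adj_adj hxy hadj h1 h2], ?_⟩
  simp only [Walk.support_cons, Walk.support_nil, List.mem_cons, List.not_mem_nil, or_false]
  grind

/-- In a graph whose edges dominate, a total mutual-visibility set of `G □ ⊤` either meets each
copy of `G` at most once, or is contained in a single copy, where it is a clique. -/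
lemma IsTotalMVSet.ncard_le_card {m : ℕ} [Finite α] [Fintype β] (hclique : G.CliqueFree (m + 1))
    (hm : m ≤ Fintype.card β) (hdom : ∀ i j c, G.Adj i j → G.Adj c i ∨ G.Adj c j)
    (hopp : ∀ a b, a ≠ b → ¬ G.Adj a b → ∃ c d, c ≠ d ∧ ¬ G.Adj c d ∧ G.Adj c a ∧ G.Adj a d ∧
      ∀ w, G.Adj c w → G.Adj w d → w = a ∨ w = b)
    {X : Set (α × β)} (hX : IsTotalMVSet (G □ (⊤ : SimpleGraph β)) X) :
    X.ncard ≤ Fintype.card β := by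
  have hadj : ∀ a b k, a ≠ b → (a, k) ∈ X → (b, k) ∈ X → G.Adj a b := by
    intro a b k hab ha hb
    by_contra hnadj
    obtain ⟨c, d, hcd, hncd, hca, had, huniq⟩ := hopp a b hab hnadj
    obtain ⟨w, h1, h2, hw⟩ := hX.exists_column_notMem hcd hncd hca had k
    rcases huniq w h1 h2 with rfl | rfl
    exacts [hw ha, hw hb]
  by_cases hinj : Set.InjOn Prod.snd X
  · rw [← hinj.ncard_image, ← Nat.card_eq_fintype_card]
    exact Set.ncard_le_card _
  obtain ⟨i, j, k, hij, hi, hj⟩ : ∃ i j k, i ≠ j ∧ (i, k) ∈ X ∧ (j, k) ∈ X := by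
    simp only [Set.InjOn, not_forall] at hinj
    obtain ⟨⟨i, k⟩, hi, ⟨j, l⟩, hj, rfl, hne⟩ := hinj
    exact ⟨i, j, k, by simpa using hne, hi, hj⟩
  have hcol : ∀ c l, (c, l) ∈ X → l = k := by
    intro c l hc
    rcases hdom i j c (hadj i j k hij hi hj) with h | h
    exacts [hX.eq_of_adj_of_mem h hc hi, hX.eq_of_adj_of_mem h hc hj]
  have hinj' : Set.InjOn Prod.fst X := by
    rintro ⟨a, l⟩ ha ⟨b, l'⟩ hb (rfl : a = b)
    rw [hcol _ _ ha, hcol _ _ hb]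
  have hcl : G.IsClique (Prod.fst '' X) := by
    rintro _ ⟨⟨a, l⟩, ha, rfl⟩ _ ⟨⟨b, l'⟩, hb, rfl⟩ hab
    obtain rfl := hcol _ _ ha
    obtain rfl := hcol _ _ hb
    exact hadj a b _ hab ha hb
  rw [← hinj'.ncard_image]
  refine le_trans ?_ hm
  by_contra! hlt
  have hfin : (Prod.fst '' X).Finite := Set.toFinite _
  refine hclique.mono hlt hfin.toFinset ⟨by simpa using hcl, ?_⟩
  rw [Set.ncard_eq_toFinset_card _ hfin]

lemma totalMVNum_boxProd_top [Fintype α] [Fintype β] [Nonempty β] {m : ℕ} (hG : G.Connected)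
    (hclique : G.CliqueFree (m + 1)) (hm : m ≤ Fintype.card β)
    (hdom : ∀ i j c, G.Adj i j → G.Adj c i ∨ G.Adj c j)
    (hopp : ∀ a b, a ≠ b → ¬ G.Adj a b → ∃ c d, c ≠ d ∧ ¬ G.Adj c d ∧ G.Adj c a ∧ G.Adj a d ∧
      ∀ w, G.Adj c w → G.Adj w d → w = a ∨ w = b)
    {a : α} (ha : IsTotalMVSet G {a}) :
    totalMVNum (G □ (⊤ : SimpleGraph β)) = Fintype.card β := by
  refine IsGreatest.csSup_eq ⟨⟨_, ha.fibre_boxProd_top hG, ?_⟩, ?_⟩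
  · have : (Prod.fst ⁻¹' {a} : Set (α × β)) = Set.range (Prod.mk a) := by
      ext ⟨b, k⟩
      simp [eq_comm]
    rw [this, ← Set.image_univ, Set.ncard_image_of_injective _ (Prod.mk_right_injective a),
      Set.ncard_univ, Nat.card_eq_fintype_card]
  · rintro _ ⟨X, hX, rfl⟩
    exact hX.ncard_le_card hclique hm hdom hopp

lemma totalMVNum_boxProd_top_eq_zero [Nonempty β] (hG : G.Connected)
    (h : ∀ a, ∃ c d, c ≠ d ∧ ¬ G.Adj c d ∧ G.Adj c a ∧ G.Adj a d ∧
      ∀ w, G.Adj c w → G.Adj w d → w = a) :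
    totalMVNum (G □ (⊤ : SimpleGraph β)) = 0 := by
  refine IsGreatest.csSup_eq ⟨⟨∅, isTotalMVSet_empty_s11 (hG.boxProd connected_top), by simp⟩, ?_⟩
  rintro _ ⟨X, hX, rfl⟩
  suffices X = ∅ by simp [this]
  refine Set.eq_empty_of_forall_notMem fun ⟨a, k⟩ hak ↦ ?_
  obtain ⟨c, d, hcd, hncd, hca, had, huniq⟩ := h a
  obtain ⟨w, h1, h2, hw⟩ := hX.exists_column_notMem hcd hncd hca had k
  exact hw (huniq w h1 h2 ▸ hak)

open scoped Fin.CommRing in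
lemma cycleGraph_exists_unique_common_neighbor (m : ℕ) (a : Fin (m + 5)) :
    ∃ c d, c ≠ d ∧ ¬ (cycleGraph (m + 5)).Adj c d ∧ (cycleGraph (m + 5)).Adj c a ∧
      (cycleGraph (m + 5)).Adj a d ∧
      ∀ w, (cycleGraph (m + 5)).Adj c w → (cycleGraph (m + 5)).Adj w d → w = a := by
  have hne : ∀ k : ℕ, 0 < k → k < 5 → (k : Fin (m + 5)) ≠ 0 := fun k hk hk5 h ↦ by
    rw [Fin.natCast_eq_zero] at h
    exact absurd (Nat.le_of_dvd hk h) (by omega)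
  have h1 := hne 1 (by omega) (by omega)
  have h2 := hne 2 (by omega) (by omega)
  have h3 := hne 3 (by omega) (by omega)
  have h4 := hne 4 (by omega) (by omega)
  push_cast at h1 h2 h3 h4
  refine ⟨a - 1, a + 1, ?_, ?_, ?_, ?_, ?_⟩ <;> try simp only [cycleGraph_adj]
  · exact fun h ↦ h2 (by linear_combination -h)
  · rintro (h | h)
    · exact h3 (by linear_combination -h)
    · exact h1 (by linear_combination h)
  · exact .inr (by ring)
  · exact .inr (by ring)
  · rintro w (h | h) (h' | h')
    · exact absurd (by linear_combination -h - h') h4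
    · exact absurd (by linear_combination h' - h) h2
    · linear_combination h
    · linear_combination h

end TotalMutualVisibility

/-- For `s ≥ 3` and `n ≥ 3`, `μt(C_s □ K_n) = 0` if `s ≥ 5` and `μt(C_s □ K_n) = n`
otherwise (i.e. for `s ∈ {3, 4}`). -/
theorem totalMVNum_cycle_boxProd_complete (s n : ℕ) (hs : 3 ≤ s) (hn : 3 ≤ n) :
    totalMVNum (SimpleGraph.cycleGraph s □ (⊤ : SimpleGraph (Fin n)))
      = if 5 ≤ s then 0 else n := by
  have : Nonempty (Fin n) := ⟨⟨0, by omega⟩⟩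
  split_ifs with h5
  · obtain ⟨m, rfl⟩ := Nat.exists_eq_add_of_le' h5
    exact totalMVNum_boxProd_top_eq_zero cycleGraph_connected
      (cycleGraph_exists_unique_common_neighbor m)
  · obtain rfl | rfl : s = 3 ∨ s = 4 := by omega
    all_goals
      refine (totalMVNum_boxProd_top (m := 3) (a := 0) cycleGraph_connected ?_ (by simpa) ?_ ?_
        (isTotalMVSet_singleton_of_common_neighbor ?_)).trans (Fintype.card_fin n)
      · unfold CliqueFree; decide
      all_goals decide
end

section
/- If T is a tree with at least 3 vertices and n ≥ 2, then μt(T □ K_n) = n · μt(T). -/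
open SimpleGraph

namespace SimpleGraph

variable {V W : Type*}

theorem _root_.IsTotalMVSet.isBypassVertex_s13 {G : SimpleGraph V} {X : Set V}
    (hX : IsTotalMVSet G X) {u : V} (hu : u ∈ X) : IsBypassVertex G u := by
  rintro ⟨x, y, hne, hxy, hxu, huy, huniq⟩
  obtain ⟨p, -, hlen, hvis⟩ := hX x y
  have hle : p.length ≤ 2 := by
    rw [hlen]
    exact dist_le (.cons hxu (.cons huy .nil))
  match p, hle, hvis with
  | .nil, _, _ => exact hne rfl
  | .cons h .nil, _, _ => exact hxy h
  | .cons h (.cons h' .nil), _, hvis =>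
    obtain rfl := huniq _ h h'
    rcases hvis _ (by simp) hu with rfl | rfl
    · exact hxu.ne rfl
    · exact huy.ne rfl
  | .cons _ (.cons _ (.cons _ q)), hle, _ =>
    simp only [Walk.length_cons] at hle
    omega

theorem _root_.IsBypassVertex.of_boxProd {G : SimpleGraph V} {H : SimpleGraph W} {u : V} {i : W}
    (h : IsBypassVertex (G □ H) (u, i)) : IsBypassVertex G u := by
  rintro ⟨x, y, hne, hxy, hxu, huy, huniq⟩
  refine h ⟨(x, i), (y, i), by simpa using hne, by simpa [boxProd_adj] using hxy,
    by simpa [boxProd_adj] using hxu, by simpa [boxProd_adj] using huy, ?_⟩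
  rintro ⟨w, j⟩ h₁ h₂
  simp only [boxProd_adj] at h₁ h₂
  rcases h₁ with ⟨h₁, rfl⟩ | ⟨h₁, rfl⟩
  · rcases h₂ with ⟨h₂, -⟩ | ⟨h₂, -⟩
    · rw [huniq w h₁ h₂]
    · exact absurd rfl h₂.ne
  · rcases h₂ with ⟨h₂, rfl⟩ | ⟨h₂, rfl⟩
    · exact absurd rfl h₁.ne
    · exact absurd rfl hne

/-- The vertices with at most one neighbour. -/
def leafSet (G : SimpleGraph V) : Set V := {u | (G.neighborSet u).Subsingleton}

theorem IsAcyclic.mem_leafSet_of_isBypassVertex {T : SimpleGraph V} (hT : T.IsAcyclic) {u : V}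
    (hu : IsBypassVertex T u) : u ∈ T.leafSet := by
  intro a ha b hb
  rw [mem_neighborSet] at ha hb
  by_contra hab
  let p : T.Path a b := ⟨.cons ha.symm (.cons hb .nil), by simp [hab, ha.ne', hb.ne]⟩
  refine hu ⟨a, b, hab, fun h ↦ ?_, ha.symm, hb, fun w haw hwb ↦ ?_⟩
  · have := congrArg (fun q : T.Path a b ↦ (q : T.Walk a b).length)
      ((hT.subsingleton_path a b).elim p (.singleton h))
    simp [p, Path.singleton] at this
  · have := congrArg (fun q : T.Path a b ↦ (q : T.Walk a b).support)
      ((hT.subsingleton_path a b).elim p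
        ⟨.cons haw (.cons hwb .nil), by simp [hab, haw.ne, hwb.ne]⟩)
    simpa [p, eq_comm] using this

theorem Walk.IsPath.eq_or_eq_of_mem_leafSet {G : SimpleGraph V} {x y : V} {p : G.Walk x y}
    (hp : p.IsPath) {z : V} (hz : z ∈ p.support) (hl : z ∈ G.leafSet) : z = x ∨ z = y := by
  induction p with
  | nil => simpa using hz
  | cons h q ih =>
    rw [Walk.cons_isPath_iff] at hp
    rw [Walk.support_cons, List.mem_cons] at hz
    refine hz.imp_right fun hz ↦ ?_
    rcases ih hp.1 hz with rfl | rfl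
    · cases q with
      | nil => rfl
      | cons h' r =>
        obtain rfl := hl h.symm h'
        exact absurd (by simp) hp.2
    · rfl

theorem Connected.isTotalMVSet_leafSet {G : SimpleGraph V} (hG : G.Connected) :
    IsTotalMVSet G G.leafSet := by
  intro x y
  obtain ⟨p, hp, hlen⟩ := hG.exists_path_of_dist x y
  exact ⟨p, hp, hlen, fun z hz hl ↦ hp.eq_or_eq_of_mem_leafSet hz hl⟩

theorem Connected.notMem_leafSet_of_adj [Fintype V] {G : SimpleGraph V} (hG : G.Connected)
    (hV : 3 ≤ Fintype.card V) {u w : V} (h : G.Adj u w) (hu : u ∈ G.leafSet) :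
    w ∉ G.leafSet := by
  classical
  intro hw
  have key {x y : V} (p : G.Walk x y) (hx : x = u ∨ x = w) : y = u ∨ y = w := by
    induction p with
    | nil => exact hx
    | cons h' q ih =>
      refine ih ?_
      rcases hx with rfl | rfl
      · exact .inr (hu h' h)
      · exact .inl (hw h' h.symm)
  have hsub : (Finset.univ : Finset V) ⊆ {u, w} := fun y _ ↦ by
    obtain ⟨p⟩ := hG u y
    simpa using key p (.inl rfl)
  have h₁ := Finset.card_le_card hsub
  have h₂ := Finset.card_le_two (a := u) (b := w)
  rw [Finset.card_univ] at h₁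
  omega

theorem Walk.length_boxProdLeft {G : SimpleGraph V} {H : SimpleGraph W} {u v : V} (b : W)
    (p : G.Walk u v) : (p.boxProdLeft H b).length = p.length :=
  p.length_map _

theorem Walk.length_boxProdRight {G : SimpleGraph V} {H : SimpleGraph W} {u v : W} (a : V)
    (p : H.Walk u v) : (p.boxProdRight G a).length = p.length :=
  p.length_map _

theorem Walk.mem_support_boxProdLeft {G : SimpleGraph V} {H : SimpleGraph W} {u v : V} {b : W}
    {p : G.Walk u v} {z : V × W} :
    z ∈ (p.boxProdLeft H b).support ↔ z.1 ∈ p.support ∧ z.2 = b := by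
  have : (p.boxProdLeft H b).support = p.support.map fun a ↦ (a, b) := p.support_map _
  rw [this, List.mem_map]
  constructor
  · rintro ⟨a, ha, rfl⟩
    exact ⟨ha, rfl⟩
  · rintro ⟨ha, rfl⟩
    exact ⟨_, ha, rfl⟩

theorem Walk.mem_support_boxProdRight {G : SimpleGraph V} {H : SimpleGraph W} {u v : W} {a : V}
    {p : H.Walk u v} {z : V × W} :
    z ∈ (p.boxProdRight G a).support ↔ z.1 = a ∧ z.2 ∈ p.support := by
  have : (p.boxProdRight G a).support = p.support.map fun b ↦ (a, b) := p.support_map _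
  rw [this, List.mem_map]
  constructor
  · rintro ⟨b, hb, rfl⟩
    exact ⟨rfl, hb⟩
  · rintro ⟨rfl, hb⟩
    exact ⟨_, hb, rfl⟩

theorem Connected.dist_boxProd {G : SimpleGraph V} {H : SimpleGraph W} (hG : G.Connected)
    (hH : H.Connected) (x y : V × W) :
    (G □ H).dist x y = G.dist x.1 y.1 + H.dist x.2 y.2 := by
  simp only [dist, edist_boxProd]
  exact ENat.toNat_add (edist_ne_top_iff_reachable.2 (hG _ _))
    (edist_ne_top_iff_reachable.2 (hH _ _))

theorem Connected.isTotalMVSet_boxProd_top [Fintype V] {G : SimpleGraph V} (hG : G.Connected)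
    (hV : 3 ≤ Fintype.card V) [Nonempty W] :
    IsTotalMVSet (G □ (⊤ : SimpleGraph W)) (G.leafSet ×ˢ Set.univ) := by
  classical
  have hW : (⊤ : SimpleGraph W).Connected := connected_top
  suffices H : ∀ x y : V × W, ∃ p : (G □ (⊤ : SimpleGraph W)).Walk x y,
      p.length = G.dist x.1 y.1 + (⊤ : SimpleGraph W).dist x.2 y.2 ∧
      ∀ z ∈ p.support, z ∈ G.leafSet ×ˢ (Set.univ : Set W) → z = x ∨ z = y by
    intro x y
    obtain ⟨p, hlen, hvis⟩ := H x y
    have hd : p.length = (G □ (⊤ : SimpleGraph W)).dist x y := by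
      rw [hlen, hG.dist_boxProd hW]
    exact ⟨p, p.isPath_of_length_eq_dist hd, hd, hvis⟩
  have layer (i j : W) : ∃ p : (⊤ : SimpleGraph W).Walk i j,
      p.length = (⊤ : SimpleGraph W).dist i j ∧ ∀ k ∈ p.support, k = i ∨ k = j := by
    by_cases h : i = j
    · subst h
      exact ⟨.nil, by simp⟩
    · exact ⟨.cons (by simpa using h) .nil, by simp [dist_top_of_ne h]⟩
  have switch {u v : V} (i j : W) (q : G.Walk u v) (hq : q.IsPath) (hu : u ∉ G.leafSet) :
      ∃ p : (G □ (⊤ : SimpleGraph W)).Walk (u, i) (v, j),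
        p.length = q.length + (⊤ : SimpleGraph W).dist i j ∧
        ∀ z ∈ p.support, z ∈ G.leafSet ×ˢ (Set.univ : Set W) → z = (v, j) := by
    obtain ⟨r, hr, -⟩ := layer i j
    refine ⟨(r.boxProdRight G u).append (q.boxProdLeft _ j), ?_, ?_⟩
    · rw [Walk.length_append, Walk.length_boxProdLeft, Walk.length_boxProdRight, hr, add_comm]
    · rintro ⟨z, k⟩ hz ⟨hl, -⟩
      rw [Walk.mem_support_append_iff, Walk.mem_support_boxProdLeft,
        Walk.mem_support_boxProdRight] at hz
      rcases hz with ⟨rfl, -⟩ | ⟨haq, rfl⟩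
      · exact absurd hl hu
      · rcases hq.eq_or_eq_of_mem_leafSet haq hl with rfl | rfl
        · exact absurd hl hu
        · rfl
  rintro ⟨u, i⟩ ⟨v, j⟩
  obtain ⟨q, hq, hlen⟩ := hG.exists_path_of_dist u v
  dsimp only
  rw [← hlen]
  by_cases hu : u ∈ G.leafSet
  · cases q with
    | nil =>
      obtain ⟨r, hr, hrs⟩ := layer i j
      refine ⟨r.boxProdRight G u, by simp [Walk.length_boxProdRight, hr], ?_⟩
      rintro ⟨z, k⟩ hz -
      obtain ⟨rfl, hk⟩ := Walk.mem_support_boxProdRight.1 hz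
      exact (hrs k hk).imp (congrArg _) (congrArg _)
    | @cons _ w _ h q =>
      obtain ⟨p, hp, hvis⟩ := switch i j q hq.of_cons (hG.notMem_leafSet_of_adj hV h hu)
      refine ⟨.cons (boxProd_adj_left.2 h) p, by simp [hp]; omega, fun z hz hl ↦ ?_⟩
      rw [Walk.support_cons, List.mem_cons] at hz
      exact hz.imp_right fun hz ↦ hvis z hz hl
  · obtain ⟨p, hp, hvis⟩ := switch i j q hq hu
    exact ⟨p, hp, fun z hz hl ↦ .inr (hvis z hz hl)⟩

theorem _root_.totalMVNum_eq_ncard [Finite V] {G : SimpleGraph V} {S : Set V}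
    (hS : IsTotalMVSet G S) (hmax : ∀ X, IsTotalMVSet G X → X ⊆ S) :
    totalMVNum G = S.ncard := by
  refine IsGreatest.csSup_eq ⟨⟨S, hS, rfl⟩, ?_⟩
  rintro _ ⟨X, hX, rfl⟩
  exact Set.ncard_le_ncard (hmax X hX)

end SimpleGraph

/-- If `T` is a tree with at least `3` vertices and `n ≥ 2`, then
`μt(T □ K_n) = n · μt(T)`. -/
theorem totalMVNum_tree_boxProd_complete {V : Type*} [Fintype V]
    (T : SimpleGraph V) (hT : T.IsTree) (hnV : 3 ≤ Fintype.card V)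
    (n : ℕ) (hn : 2 ≤ n) :
    totalMVNum (T □ (⊤ : SimpleGraph (Fin n))) = n * totalMVNum T := by
  have : Nonempty (Fin n) := ⟨⟨0, by omega⟩⟩
  rw [totalMVNum_eq_ncard (hT.connected.isTotalMVSet_boxProd_top hnV)
      fun X hX u hu ↦ ⟨hT.isAcyclic.mem_leafSet_of_isBypassVertex
        (hX.isBypassVertex_s13 hu).of_boxProd, trivial⟩,
    totalMVNum_eq_ncard hT.connected.isTotalMVSet_leafSet
      fun X hX u hu ↦ hT.isAcyclic.mem_leafSet_of_isBypassVertex (hX.isBypassVertex_s13 hu),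
    Set.ncard_prod, Set.ncard_univ, Nat.card_fin, mul_comm]
end

section
/- If T is a tree with at least 3 vertices, then μt(T) equals the number of leaves of T, and moreover the set of leaves of T is an independent total mutual-visibility set, so μit(T) = μt(T). -/
open SimpleGraph

/-- A vertex of degree one lying on a path is an endpoint of that path. -/
theorem SimpleGraph.Walk.IsPath.eq_or_eq_of_degree_eq_one {V : Type*} {G : SimpleGraph V}
    {x y z : V} [Fintype (G.neighborSet z)] {p : G.Walk x y} (hp : p.IsPath)
    (hz : z ∈ p.support) (hdeg : G.degree z = 1) : z = x ∨ z = y := by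
  obtain ⟨u, -, hu⟩ := degree_eq_one_iff_existsUnique_adj.mp hdeg
  by_contra! h
  exact hp.isTrail.not_mem_support_of_subsingleton_neighborSet h.1 h.2
    (fun a ha b hb => (hu a ha).trans (hu b hb).symm) hz

/-- The vertices of degree one of a connected graph form a total mutual-visibility set. -/
theorem SimpleGraph.Connected.isTotalMVSet_degree_eq_one {V : Type*} {G : SimpleGraph V}
    [G.LocallyFinite] (hG : G.Connected) : IsTotalMVSet G {v : V | G.degree v = 1} := by
  intro x y
  obtain ⟨p, hp, hlen⟩ := hG.exists_path_of_dist x y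
  exact ⟨p, hp, hlen, fun z hz hdeg => hp.eq_or_eq_of_degree_eq_one hz hdeg⟩

/-- In a connected graph on at least three vertices, no two vertices of degree one are
adjacent. -/
theorem SimpleGraph.Connected.isIndepVSet_degree_eq_one {V : Type*} [Fintype V]
    {G : SimpleGraph V} [G.LocallyFinite] (hG : G.Connected) (hV : 3 ≤ Fintype.card V) :
    IsIndepVSet G {v : V | G.degree v = 1} := by
  classical
  intro x hx y hy hxy
  obtain ⟨z, hz⟩ : ∃ z, z ∉ ({x, y} : Finset V) := by
    by_contra! h
    have h₁ := Finset.card_le_card (fun z _ => h z : Finset.univ ⊆ ({x, y} : Finset V))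
    have h₂ := Finset.card_le_two (a := x) (b := y)
    rw [Finset.card_univ] at h₁
    omega
  simp only [Finset.mem_insert, Finset.mem_singleton, not_or] at hz
  obtain ⟨p, hp⟩ := hG.exists_isPath x z
  have hnil : ¬ p.Nil := Walk.not_nil_of_ne (Ne.symm hz.1)
  obtain ⟨u, -, hu⟩ := degree_eq_one_iff_existsUnique_adj.mp hx
  have hsnd : p.snd = y := (hu _ (p.adj_snd hnil)).trans (hu _ hxy).symm
  have hmem : y ∈ p.support := hsnd ▸ p.getVert_mem_support 1
  rcases hp.eq_or_eq_of_degree_eq_one hmem hy with h | h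
  · exact hxy.ne h.symm
  · exact hz.2 h.symm

/-- A total mutual-visibility set of a nontrivial tree consists of leaves. -/
theorem IsTotalMVSet.subset_degree_eq_one {V : Type*} [Nontrivial V] {T : SimpleGraph V}
    [T.LocallyFinite] (hT : T.IsTree) {X : Set V} (hX : IsTotalMVSet T X) :
    X ⊆ {v : V | T.degree v = 1} := by
  intro v hv
  by_contra hdeg
  obtain ⟨x, y, hx, hy, hxy⟩ : ∃ x y, T.Adj v x ∧ T.Adj v y ∧ x ≠ y := by
    have hpos := hT.connected.preconnected.degree_pos_of_nontrivial v
    obtain ⟨x, hx, y, hy, hxy⟩ := Finset.one_lt_card.mp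
      (show 1 < (T.neighborFinset v).card from lt_of_le_of_ne hpos (Ne.symm hdeg))
    exact ⟨x, y, by simpa using hx, by simpa using hy, hxy⟩
  obtain ⟨p, hp, -, hvis⟩ := hX x y
  have hq : (Walk.cons hx.symm (Walk.cons hy Walk.nil)).IsPath := by
    simp [Walk.cons_isPath_iff, hx.ne', hy.ne, hxy]
  have hpq := (hT.existsUnique_path x y).unique hp hq
  rcases hvis v (by simp [hpq]) hv with h | h
  · exact hx.ne h
  · exact hy.ne h

/-- If `T` is a tree with at least `3` vertices, then `μt(T)` equals the number of leaves
of `T`; moreover the set of leaves is an independent total mutual-visibility set, and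
`μit(T) = μt(T)`. -/
theorem totalMVNum_tree_eq_leaves {V : Type*} [Fintype V]
    (T : SimpleGraph V) [DecidableRel T.Adj] (hT : T.IsTree) (hnV : 3 ≤ Fintype.card V) :
    totalMVNum T = {v : V | T.degree v = 1}.ncard ∧
      IsTotalMVSet T {v : V | T.degree v = 1} ∧
      IsIndepVSet T {v : V | T.degree v = 1} ∧
      indepTotalMVNum T = totalMVNum T := by
  have : Nontrivial V := Fintype.one_lt_card_iff_nontrivial.mp (by omega)
  have hmv := hT.connected.isTotalMVSet_degree_eq_one
  have hind := hT.connected.isIndepVSet_degree_eq_one hnV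
  have hle {X : Set V} (hX : IsTotalMVSet T X) : X.ncard ≤ {v : V | T.degree v = 1}.ncard :=
    Set.ncard_le_ncard (hX.subset_degree_eq_one hT) (Set.toFinite _)
  have htotal : totalMVNum T = {v : V | T.degree v = 1}.ncard :=
    IsGreatest.csSup_eq ⟨⟨_, hmv, rfl⟩, by rintro _ ⟨X, hX, rfl⟩; exact hle hX⟩
  have hindep : indepTotalMVNum T = {v : V | T.degree v = 1}.ncard :=
    IsGreatest.csSup_eq ⟨⟨_, hmv, hind, rfl⟩, by rintro _ ⟨X, hX, -, rfl⟩; exact hle hX⟩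
  exact ⟨htotal, hmv, hind, hindep.trans htotal.symm⟩
end
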